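/- arXiv:quant-ph/0510102 — 7 statements merged into one kernel-verified Lean document; each statement's English description precedes it below -/
import Mathlib

section
/- Let L be a complete lattice. The map φ sending a bounded right-continuous spectral family E in L to the family φ(E) defined by φ(E)_λ = ⨆_{μ<λ} E_μ is a bijection from the set of bounded right-continuous spectral families in L onto the set of bounded left-continuous spectral families in L, with inverse sending a bounded left-continuous spectral family F to the family λ ↦ ⨅_{μ>λ} F_μ. In particular: (a) φ(E) is a bounded left-continuous spectral family; (b) for every bounded left-continuous spectral family F, the family λ ↦ ⨅_{μ>λ} F_μ is a bounded right-continuous spectral family; (c) ⨅_{μ>λ} (⨆_{ν<μ} E_ν) = E_λ for all λ; (d) ⨆_{μ<λ} (⨅_{ν>μ} F_ν) = F_λ for all λ. -/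
/-- A bounded right-continuous spectral family in a complete lattice `L`. -/
def IsBoundedRightContinuousSpectralFamily {L : Type*} [CompleteLattice L] (E : ℝ → L) : Prop :=
  Monotone E ∧ (∀ l : ℝ, E l = ⨅ μ, ⨅ _ : l < μ, E μ) ∧
    ∃ a b : ℝ, a ≤ b ∧ (∀ l : ℝ, l < a → E l = ⊥) ∧ ∀ l : ℝ, b < l → E l = ⊤

/-- A bounded left-continuous spectral family in a complete lattice `L`. -/
def IsBoundedLeftContinuousSpectralFamily {L : Type*} [CompleteLattice L] (F : ℝ → L) : Prop :=
  Monotone F ∧ (∀ l : ℝ, F l = ⨆ μ, ⨆ _ : μ < l, F μ) ∧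
    ∃ a b : ℝ, a ≤ b ∧ (∀ l : ℝ, l < a → F l = ⊥) ∧ ∀ l : ℝ, b < l → F l = ⊤

theorem iSup_lt_iSup_lt {L : Type*} [CompleteLattice L] (E : ℝ → L) (l : ℝ) :
    (⨆ μ, ⨆ _ : μ < l, ⨆ ν, ⨆ _ : ν < μ, E ν) = ⨆ ν, ⨆ _ : ν < l, E ν := by
  apply le_antisymm
  · exact iSup₂_le fun μ hμ => iSup₂_le fun ν hν => le_iSup₂_of_le ν (hν.trans hμ) le_rfl
  · refine iSup₂_le fun ν hν => ?_
    obtain ⟨μ, h₁, h₂⟩ := exists_between hν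
    exact le_iSup₂_of_le μ h₂ (le_iSup₂_of_le ν h₁ le_rfl)

theorem iInf_gt_iInf_gt {L : Type*} [CompleteLattice L] (F : ℝ → L) (l : ℝ) :
    (⨅ μ, ⨅ _ : l < μ, ⨅ ν, ⨅ _ : μ < ν, F ν) = ⨅ ν, ⨅ _ : l < ν, F ν := by
  apply le_antisymm
  · refine le_iInf₂ fun ν hν => ?_
    obtain ⟨μ, h₁, h₂⟩ := exists_between hν
    exact iInf₂_le_of_le μ h₁ (iInf₂_le_of_le ν h₂ le_rfl)
  · exact le_iInf₂ fun μ hμ => le_iInf₂ fun ν hν => iInf₂_le_of_le ν (hμ.trans hν) le_rfl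

theorem Monotone.iInf_gt_iSup_lt {L : Type*} [CompleteLattice L] {E : ℝ → L} (hE : Monotone E)
    (l : ℝ) : (⨅ μ, ⨅ _ : l < μ, ⨆ ν, ⨆ _ : ν < μ, E ν) = ⨅ μ, ⨅ _ : l < μ, E μ := by
  apply le_antisymm
  · exact le_iInf₂ fun μ hμ => iInf₂_le_of_le μ hμ (iSup₂_le fun ν hν => hE hν.le)
  · refine le_iInf₂ fun μ hμ => ?_
    obtain ⟨ν, h₁, h₂⟩ := exists_between hμ
    exact iInf₂_le_of_le ν h₁ (le_iSup₂_of_le ν h₂ le_rfl)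

theorem Monotone.iSup_lt_iInf_gt {L : Type*} [CompleteLattice L] {F : ℝ → L} (hF : Monotone F)
    (l : ℝ) : (⨆ μ, ⨆ _ : μ < l, ⨅ ν, ⨅ _ : μ < ν, F ν) = ⨆ μ, ⨆ _ : μ < l, F μ := by
  apply le_antisymm
  · refine iSup₂_le fun μ hμ => ?_
    obtain ⟨ν, h₁, h₂⟩ := exists_between hμ
    exact le_iSup₂_of_le ν h₂ (iInf₂_le_of_le ν h₁ le_rfl)
  · exact iSup₂_le fun μ hμ => le_iSup₂_of_le μ hμ (le_iInf₂ fun ν hν => hF hν.le)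

theorem IsBoundedRightContinuousSpectralFamily.iSup_lt {L : Type*} [CompleteLattice L]
    {E : ℝ → L} (hE : IsBoundedRightContinuousSpectralFamily E) :
    IsBoundedLeftContinuousSpectralFamily (fun l : ℝ => ⨆ μ, ⨆ _ : μ < l, E μ) := by
  obtain ⟨-, -, a, b, hab, ha, hb⟩ := hE
  refine ⟨fun x y hxy => ?_, fun l => (iSup_lt_iSup_lt E l).symm, a, b, hab,
    fun l hl => ?_, fun l hl => ?_⟩
  · exact iSup₂_le fun μ hμ => le_iSup₂_of_le μ (hμ.trans_le hxy) le_rfl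
  · exact le_bot_iff.1 (iSup₂_le fun μ hμ => (ha μ (hμ.trans hl)).le)
  · obtain ⟨μ, h₁, h₂⟩ := exists_between hl
    exact top_le_iff.1 (le_iSup₂_of_le μ h₂ (hb μ h₁).ge)

theorem IsBoundedLeftContinuousSpectralFamily.iInf_gt {L : Type*} [CompleteLattice L]
    {F : ℝ → L} (hF : IsBoundedLeftContinuousSpectralFamily F) :
    IsBoundedRightContinuousSpectralFamily (fun l : ℝ => ⨅ μ, ⨅ _ : l < μ, F μ) := by
  obtain ⟨-, -, a, b, hab, ha, hb⟩ := hF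
  refine ⟨fun x y hxy => ?_, fun l => (iInf_gt_iInf_gt F l).symm, a, b, hab,
    fun l hl => ?_, fun l hl => ?_⟩
  · exact le_iInf₂ fun μ hμ => iInf₂_le_of_le μ (hxy.trans_lt hμ) le_rfl
  · obtain ⟨μ, h₁, h₂⟩ := exists_between hl
    exact le_bot_iff.1 (iInf₂_le_of_le μ h₁ (ha μ h₂).le)
  · exact top_le_iff.1 (le_iInf₂ fun μ hμ => (hb μ (hl.trans hμ)).ge)

/-- The map `φ(E)_λ = ⨆_{μ<λ} E_μ` is a bijection from bounded right-continuous spectral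
families onto bounded left-continuous spectral families, with inverse
`F ↦ (λ ↦ ⨅_{μ>λ} F_μ)`. -/
theorem antonymous_stmt0 {L : Type*} [CompleteLattice L] :
    Set.BijOn (fun (E : ℝ → L) => fun l : ℝ => ⨆ μ, ⨆ _ : μ < l, E μ)
      {E : ℝ → L | IsBoundedRightContinuousSpectralFamily E}
      {F : ℝ → L | IsBoundedLeftContinuousSpectralFamily F} ∧
    Set.InvOn (fun (F : ℝ → L) => fun l : ℝ => ⨅ μ, ⨅ _ : l < μ, F μ)
      (fun (E : ℝ → L) => fun l : ℝ => ⨆ μ, ⨆ _ : μ < l, E μ)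
      {E : ℝ → L | IsBoundedRightContinuousSpectralFamily E}
      {F : ℝ → L | IsBoundedLeftContinuousSpectralFamily F} ∧
    (∀ E : ℝ → L, IsBoundedRightContinuousSpectralFamily E →
      IsBoundedLeftContinuousSpectralFamily (fun l : ℝ => ⨆ μ, ⨆ _ : μ < l, E μ)) ∧
    (∀ F : ℝ → L, IsBoundedLeftContinuousSpectralFamily F →
      IsBoundedRightContinuousSpectralFamily (fun l : ℝ => ⨅ μ, ⨅ _ : l < μ, F μ)) ∧
    (∀ E : ℝ → L, IsBoundedRightContinuousSpectralFamily E →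
      ∀ l : ℝ, (⨅ μ, ⨅ _ : l < μ, ⨆ ν, ⨆ _ : ν < μ, E ν) = E l) ∧
    (∀ F : ℝ → L, IsBoundedLeftContinuousSpectralFamily F →
      ∀ l : ℝ, (⨆ μ, ⨆ _ : μ < l, ⨅ ν, ⨅ _ : μ < ν, F ν) = F l) := by
  have iInf_iSup_eq : ∀ E : ℝ → L, IsBoundedRightContinuousSpectralFamily E →
      ∀ l : ℝ, (⨅ μ, ⨅ _ : l < μ, ⨆ ν, ⨆ _ : ν < μ, E ν) = E l :=
    fun E hE l => (hE.1.iInf_gt_iSup_lt l).trans (hE.2.1 l).symm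
  have iSup_iInf_eq : ∀ F : ℝ → L, IsBoundedLeftContinuousSpectralFamily F →
      ∀ l : ℝ, (⨆ μ, ⨆ _ : μ < l, ⨅ ν, ⨅ _ : μ < ν, F ν) = F l :=
    fun F hF l => (hF.1.iSup_lt_iInf_gt l).trans (hF.2.1 l).symm
  have inv : Set.InvOn (fun (F : ℝ → L) => fun l : ℝ => ⨅ μ, ⨅ _ : l < μ, F μ)
      (fun (E : ℝ → L) => fun l : ℝ => ⨆ μ, ⨆ _ : μ < l, E μ)
      {E : ℝ → L | IsBoundedRightContinuousSpectralFamily E}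
      {F : ℝ → L | IsBoundedLeftContinuousSpectralFamily F} :=
    ⟨fun E hE => funext (iInf_iSup_eq E hE), fun F hF => funext (iSup_iInf_eq F hF)⟩
  exact ⟨inv.bijOn (fun _ hE => hE.iSup_lt) (fun _ hF => hF.iInf_gt), inv,
    fun _ hE => hE.iSup_lt, fun _ hF => hF.iInf_gt, iInf_iSup_eq, iSup_iInf_eq⟩
end

section
/- Let L be a complete lattice, let G : ℝ → L be an antitone family, and let B ⊆ L be upward closed (a ∈ B and a ≤ b imply b ∈ B). Define H_λ := ⨅_{μ<λ} G_μ for λ ∈ ℝ. Then sSup {λ ∈ ℝ | G_λ ∈ B} = sSup {λ ∈ ℝ | H_λ ∈ B}; indeed, the two sets {λ | G_λ ∈ B} and {λ | H_λ ∈ B} are downward closed subsets of ℝ with the same supremum (and one is empty, respectively unbounded above, if and only if the other is). -/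
theorem Real.sSup_eq_sSup_of_upperBounds_eq {S T : Set ℝ} (hne : S = ∅ ↔ T = ∅)
    (h : upperBounds S = upperBounds T) : sSup S = sSup T := by
  rcases S.eq_empty_or_nonempty with hS | hS
  · rw [hS, hne.1 hS]
  have hT : T.Nonempty := Set.nonempty_iff_ne_empty.2 fun hT => hS.ne_empty (hne.2 hT)
  by_cases hb : BddAbove S
  · refine ((isLUB_csSup hS hb).csSup_eq hS).trans (IsLUB.csSup_eq ?_ hT).symm
    rw [IsLUB, ← h]
    exact isLUB_csSup hS hb
  · have hb' : ¬ BddAbove T := by rwa [BddAbove, ← h]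
    rw [Real.sSup_of_not_bddAbove hb, Real.sSup_of_not_bddAbove hb']

theorem upperBounds_eq_of_subset_of_forall_lt_mem {α : Type*} [LinearOrder α] [DenselyOrdered α]
    {S T : Set α} (hST : S ⊆ T) (hT : ∀ l ∈ T, ∀ m < l, m ∈ S) :
    upperBounds S = upperBounds T :=
  Set.Subset.antisymm
    (fun _ hx l hl => le_of_forall_lt_imp_le_of_dense fun m hm => hx (hT l hl m hm))
    (upperBounds_mono_set hST)


/-- Passing from an antitone family `G` to its left-continuous version
`H_λ = ⨅_{μ<λ} G_μ` does not change membership suprema with respect to an upward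
closed set `B`: the two sets `{λ | G_λ ∈ B}` and `{λ | H_λ ∈ B}` are downward closed
with the same supremum, and one is empty (resp. unbounded above) iff the other is. -/
theorem antonymous_stmt2 {L : Type*} [CompleteLattice L] (G : ℝ → L) (hG : Antitone G)
    (B : Set L) (hB : ∀ a ∈ B, ∀ b : L, a ≤ b → b ∈ B) :
    sSup {l : ℝ | G l ∈ B} = sSup {l : ℝ | (⨅ μ, ⨅ _ : μ < l, G μ) ∈ B} ∧
    (∀ l : ℝ, G l ∈ B → ∀ l' : ℝ, l' ≤ l → G l' ∈ B) ∧
    (∀ l : ℝ, (⨅ μ, ⨅ _ : μ < l, G μ) ∈ B → ∀ l' : ℝ, l' ≤ l →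
      (⨅ μ, ⨅ _ : μ < l', G μ) ∈ B) ∧
    ({l : ℝ | G l ∈ B} = ∅ ↔ {l : ℝ | (⨅ μ, ⨅ _ : μ < l, G μ) ∈ B} = ∅) ∧
    (BddAbove {l : ℝ | G l ∈ B} ↔ BddAbove {l : ℝ | (⨅ μ, ⨅ _ : μ < l, G μ) ∈ B}) := by
  have hST : {l : ℝ | G l ∈ B} ⊆ {l : ℝ | (⨅ μ, ⨅ _ : μ < l, G μ) ∈ B} :=
    fun l hl => hB _ hl _ (le_iInf₂ fun _ hμ => hG hμ.le)
  have hT : ∀ l ∈ {l : ℝ | (⨅ μ, ⨅ _ : μ < l, G μ) ∈ B}, ∀ m < l, m ∈ {l : ℝ | G l ∈ B} :=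
    fun l hl m hm => hB _ hl _ (iInf₂_le m hm)
  have hub := upperBounds_eq_of_subset_of_forall_lt_mem hST hT
  have hne : {l : ℝ | G l ∈ B} = ∅ ↔ {l : ℝ | (⨅ μ, ⨅ _ : μ < l, G μ) ∈ B} = ∅ := by
    refine ⟨fun h => Set.eq_empty_of_forall_notMem fun l hl => ?_,
      fun h => Set.subset_eq_empty hST h⟩
    exact Set.eq_empty_iff_forall_notMem.1 h (l - 1) (hT l hl _ (sub_one_lt l))
  refine ⟨Real.sSup_eq_sSup_of_upperBounds_eq hne hub,
    fun l hl l' hl' => hB _ hl _ (hG hl'), fun l hl l' hl' => hB _ hl _ ?_, hne, ?_⟩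
  · exact biInf_mono fun _ hμ => hμ.trans_le hl'
  · rw [BddAbove, BddAbove, hub]
end

section
/- Let L be a complete lattice and let P ∈ L with P ≠ ⊥. Define G : ℝ → L by G_λ = ⊤ for λ ≤ 0, G_λ = P for 0 < λ ≤ 1, and G_λ = ⊥ for λ > 1 (this is the opposite spectral family of the projection P). Then G is a bounded opposite spectral family, and for every quasipoint 𝔅 of L: if P ∈ 𝔅 then g_G(𝔅) = sSup {λ ∈ ℝ | G_λ ∈ 𝔅} = 1, and if P ∉ 𝔅 then g_G(𝔅) = 0. That is, the antonymous function of G is the characteristic function of the set Q_P = {𝔅 | P ∈ 𝔅}. -/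
/-- A dual ideal in a complete lattice. -/
def IsDualIdeal {L : Type*} [CompleteLattice L] (D : Set L) : Prop :=
  D.Nonempty ∧ ⊥ ∉ D ∧ (∀ a ∈ D, ∀ b ∈ D, a ⊓ b ∈ D) ∧ ∀ a ∈ D, ∀ b : L, a ≤ b → b ∈ D

/-- A quasipoint: a maximal dual ideal. -/
def IsQuasipoint {L : Type*} [CompleteLattice L] (D : Set L) : Prop :=
  IsDualIdeal D ∧ ∀ D' : Set L, IsDualIdeal D' → D ⊆ D' → D' = D

/-- A bounded opposite spectral family in a complete lattice. -/
def IsBoundedOppositeSpectralFamily {L : Type*} [CompleteLattice L] (G : ℝ → L) : Prop :=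
  Antitone G ∧ (∀ l : ℝ, G l = ⨅ μ, ⨅ _ : μ < l, G μ) ∧
    ∃ a b : ℝ, a ≤ b ∧ (∀ l : ℝ, l < a → G l = ⊤) ∧ ∀ l : ℝ, b < l → G l = ⊥

/-- The opposite spectral family of a nonzero projection `P` is a bounded opposite
spectral family, and its antonymous function is the characteristic function of
`Q_P = {𝔅 | P ∈ 𝔅}`: it takes the value `1` on quasipoints containing `P` and the
value `0` on all other quasipoints. -/
theorem antonymous_stmt4 {L : Type*} [CompleteLattice L] (P : L) (hP : P ≠ ⊥)
    (G : ℝ → L)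
    (hGdef : ∀ l : ℝ, G l = if l ≤ 0 then ⊤ else if l ≤ 1 then P else ⊥) :
    IsBoundedOppositeSpectralFamily G ∧
    ∀ B : Set L, IsQuasipoint B →
      (P ∈ B → sSup {l : ℝ | G l ∈ B} = 1) ∧ (P ∉ B → sSup {l : ℝ | G l ∈ B} = 0) := by
  have top_of {l : ℝ} (h : l ≤ 0) : G l = ⊤ := by rw [hGdef, if_pos h]
  have mid_of {l : ℝ} (h : 0 < l) (h' : l ≤ 1) : G l = P := by
    rw [hGdef, if_neg h.not_ge, if_pos h']
  have bot_of {l : ℝ} (h : 1 < l) : G l = ⊥ := by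
    rw [hGdef, if_neg (zero_lt_one.trans h).not_ge, if_neg h.not_ge]
  have anti : Antitone G := by
    intro x y hxy
    rcases le_or_gt x 0 with hx | hx
    · simp [top_of hx]
    rcases le_or_gt y 1 with hy | hy
    · rw [mid_of hx (hxy.trans hy), mid_of (hx.trans_le hxy) hy]
    · simp [bot_of hy]
  refine ⟨⟨anti, fun l => le_antisymm (le_iInf₂ fun μ hμ => anti hμ.le) ?_,
    0, 1, zero_le_one, fun l hl => top_of hl.le, fun l hl => bot_of hl⟩, ?_⟩
  · rcases le_or_gt l 0 with h0 | h0
    · simp [top_of h0]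
    rcases le_or_gt l 1 with h1 | h1
    · refine (iInf₂_le (l / 2) (by linarith)).trans_eq ?_
      rw [mid_of h0 h1, mid_of (by linarith) (by linarith)]
    · refine (iInf₂_le ((1 + l) / 2) (by linarith)).trans_eq ?_
      rw [bot_of h1, bot_of (by linarith)]
  · rintro B ⟨⟨⟨x, hx⟩, hbot, -, hup⟩, -⟩
    have top_mem : ⊤ ∈ B := hup x hx ⊤ le_top
    have le_one {l : ℝ} (hl : G l ∈ B) : l ≤ 1 := by
      by_contra! h
      exact hbot (bot_of h ▸ hl)
    constructor
    · intro hPB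
      refine IsGreatest.csSup_eq ⟨?_, fun l hl => le_one hl⟩
      simpa [mid_of zero_lt_one le_rfl] using hPB
    · intro hPB
      refine IsGreatest.csSup_eq ⟨?_, fun l hl => ?_⟩
      · simpa [top_of le_rfl] using top_mem
      · by_contra! h
        exact hPB (mid_of h (le_one hl) ▸ hl)
end

section
/- Let L be a complete lattice with ⊥ ≠ ⊤, and let c : L → L be an orthocomplementation satisfying: c is antitone; c is involutive (c(c(x)) = x for all x); x ⊓ c(x) = ⊥ for all x; c(⊥) = ⊤; and the orthomodularity property that whenever x ≤ y and y ⊓ c(x) = ⊥ then x = y. Let F be a bounded left-continuous spectral family in L and define its spectrum sp(F) := {λ ∈ ℝ | F_{λ−ε} ≠ F_{λ+ε} for every ε > 0}. Define g(𝔅) := sSup {λ ∈ ℝ | c(F_λ) ∈ 𝔅} for each quasipoint 𝔅 of L. Then the image {g(𝔅) | 𝔅 a quasipoint of L} equals sp(F). -/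
/-- Every dual ideal is contained in a quasipoint. -/
theorem IsDualIdeal.exists_isQuasipoint_superset {L : Type*} [CompleteLattice L] {D : Set L}
    (hD : IsDualIdeal D) : ∃ B : Set L, D ⊆ B ∧ IsQuasipoint B := by
  obtain ⟨B, hDB, hB⟩ := zorn_subset_nonempty {D : Set L | IsDualIdeal D} (by
    rintro C hC hchain ⟨E, hE⟩
    refine ⟨⋃₀ C, ⟨?_, ?_, ?_, ?_⟩, fun s hs => Set.subset_sUnion_of_mem hs⟩
    · obtain ⟨x, hx⟩ := (hC hE).1
      exact ⟨x, E, hE, hx⟩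
    · rintro ⟨s, hs, hbot⟩
      exact (hC hs).2.1 hbot
    · rintro a ⟨s, hs, ha⟩ b ⟨t, ht, hb⟩
      rcases hchain.total hs ht with hst | hts
      · exact ⟨t, ht, (hC ht).2.2.1 a (hst ha) b hb⟩
      · exact ⟨s, hs, (hC hs).2.2.1 a ha b (hts hb)⟩
    · rintro a ⟨s, hs, ha⟩ b hab
      exact ⟨s, hs, (hC hs).2.2.2 a ha b hab⟩) D hD
  exact ⟨B, hDB, hB.prop, fun D' hD' hBD' => (hB.eq_of_subset hD' hBD').symm⟩

/-- The upward closure of an increasing family of nonzero elements indexed by the positive reals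
is a dual ideal. -/
theorem isDualIdeal_setOf_exists_pos_le {L : Type*} [CompleteLattice L] {p : ℝ → L}
    (hp : Monotone p) (hne : ∀ ε : ℝ, 0 < ε → p ε ≠ ⊥) :
    IsDualIdeal {x : L | ∃ ε : ℝ, 0 < ε ∧ p ε ≤ x} := by
  refine ⟨⟨⊤, 1, one_pos, le_top⟩, ?_, ?_, ?_⟩
  · rintro ⟨ε, hε, h⟩
    exact hne ε hε (le_bot_iff.mp h)
  · rintro a ⟨ε, hε, ha⟩ b ⟨δ, hδ, hb⟩
    exact ⟨min ε δ, lt_min hε hδ,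
      le_inf ((hp (min_le_left _ _)).trans ha) ((hp (min_le_right _ _)).trans hb)⟩
  · rintro a ⟨ε, hε, ha⟩ b hab
    exact ⟨ε, hε, ha.trans hab⟩


/-- Let `c` be an orthocomplementation on a nontrivial complete lattice `L` (antitone,
involutive, `x ⊓ c x = ⊥`, `c ⊥ = ⊤`, orthomodular). For a bounded left-continuous
spectral family `F`, the image of the antonymous function
`g(𝔅) = sSup {λ | c (F λ) ∈ 𝔅}` over all quasipoints `𝔅` equals the spectrum
`sp F = {λ | ∀ ε > 0, F (λ - ε) ≠ F (λ + ε)}`. -/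
theorem antonymous_stmt7 {L : Type*} [CompleteLattice L] (hL : (⊥ : L) ≠ ⊤)
    (c : L → L) (hc_anti : Antitone c) (hc_inv : ∀ x : L, c (c x) = x)
    (hc_meet : ∀ x : L, x ⊓ c x = ⊥) (hc_bot : c (⊥ : L) = ⊤)
    (hc_om : ∀ x y : L, x ≤ y → y ⊓ c x = ⊥ → x = y)
    (F : ℝ → L) (hF : IsBoundedLeftContinuousSpectralFamily F) :
    {r : ℝ | ∃ B : Set L, IsQuasipoint B ∧ sSup {l : ℝ | c (F l) ∈ B} = r} =
      {l : ℝ | ∀ ε : ℝ, 0 < ε → F (l - ε) ≠ F (l + ε)} := by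
  obtain ⟨hmono, -, a, b, -, ha, hb⟩ := hF
  have hc_top : c ⊤ = ⊥ := by rw [← hc_bot, hc_inv]
  ext r
  constructor
  · rintro ⟨B, ⟨⟨⟨x, hx⟩, hbot, -, hup⟩, -⟩, rfl⟩ ε hε heq
    have hne : {l : ℝ | c (F l) ∈ B}.Nonempty := by
      refine ⟨a - 1, ?_⟩
      rw [Set.mem_ofPred_eq, ha _ (by linarith), hc_bot]
      exact hup x hx ⊤ le_top
    have hbdd : BddAbove {l : ℝ | c (F l) ∈ B} := by
      refine ⟨b, fun l hl => ?_⟩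
      by_contra! hlt
      rw [Set.mem_ofPred_eq, hb l hlt, hc_top] at hl
      exact hbot hl
    obtain ⟨l, hl, hlt⟩ := exists_lt_of_lt_csSup hne (sub_lt_self _ hε)
    have hmem := hup _ hl _ (hc_anti (hmono hlt.le))
    rw [heq] at hmem
    linarith [le_csSup hbdd hmem]
  · intro hr
    have hp : Monotone fun ε : ℝ => F (r + ε) ⊓ c (F (r - ε)) := fun ε δ h =>
      inf_le_inf (hmono (by linarith)) (hc_anti (hmono (by linarith)))
    obtain ⟨B, hDB, hB⟩ := (isDualIdeal_setOf_exists_pos_le hp fun ε hε h =>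
      hr ε hε (hc_om _ _ (hmono (by linarith)) h)).exists_isQuasipoint_superset
    have hlower : ∀ l < r, c (F l) ∈ B := fun l hl =>
      hDB ⟨r - l, sub_pos.mpr hl, by simp⟩
    have hupper : ∀ l, c (F l) ∈ B → l ≤ r := by
      intro l hl
      by_contra! hlt
      have hFl : F l ∈ B := hDB ⟨l - r, sub_pos.mpr hlt, by simp⟩
      exact hB.1.2.1 (hc_meet (F l) ▸ hB.1.2.2.1 _ hFl _ hl)
    refine ⟨B, hB, csSup_eq_of_forall_le_of_forall_lt_exists_gt
      ⟨r - 1, hlower _ (sub_one_lt r)⟩ hupper fun w hw => ?_⟩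
    obtain ⟨l, hwl, hlr⟩ := exists_between hw
    exact ⟨l, hlower l hlr, hwl⟩
end

section
/- Let L be a complete lattice, let G be a bounded opposite spectral family in L, and let t ∈ ℝ. Then the shifted family λ ↦ G_{λ−t} is again a bounded opposite spectral family, and for every quasipoint 𝔅 of L, sSup {λ ∈ ℝ | G_{λ−t} ∈ 𝔅} = t + sSup {λ ∈ ℝ | G_λ ∈ 𝔅}. (The shifted family is the opposite spectral family of A + tI when G is that of A; hence g_{A+tI} = t + g_A.) -/
/-- Translating the argument of a bounded opposite spectral family preserves it. -/
theorem IsBoundedOppositeSpectralFamily.comp_sub_const {L : Type*} [CompleteLattice L]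
    {G : ℝ → L} (hG : IsBoundedOppositeSpectralFamily G) (t : ℝ) :
    IsBoundedOppositeSpectralFamily (fun l : ℝ => G (l - t)) := by
  obtain ⟨hanti, hinf, a, b, hab, ha, hb⟩ := hG
  refine ⟨fun x y hxy => hanti (sub_le_sub_right hxy t), fun l => ?_, a + t, b + t,
    by linarith, fun l hl => ha _ (by linarith), fun l hl => hb _ (by linarith)⟩
  refine le_antisymm (le_iInf₂ fun μ hμ => hanti (by linarith)) ?_
  change _ ≤ G (l - t)
  rw [hinf (l - t)]
  refine le_iInf₂ fun μ hμ => ?_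
  refine (iInf₂_le (μ + t) (by linarith)).trans_eq ?_
  simp only [add_sub_cancel_right]

/-- Some member of a bounded opposite spectral family lies in any given dual ideal. -/
theorem IsBoundedOppositeSpectralFamily.nonempty_setOf_mem {L : Type*} [CompleteLattice L]
    {G : ℝ → L} (hG : IsBoundedOppositeSpectralFamily G) {D : Set L} (hD : IsDualIdeal D) :
    {l : ℝ | G l ∈ D}.Nonempty := by
  obtain ⟨-, -, a, -, -, ha, -⟩ := hG
  obtain ⟨⟨x, hx⟩, -, -, hup⟩ := hD
  refine ⟨a - 1, ?_⟩
  rw [Set.mem_ofPred_eq, ha _ (by linarith)]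
  exact hup x hx ⊤ le_top

/-- The parameters at which a bounded opposite spectral family meets a dual ideal are
bounded above. -/
theorem IsBoundedOppositeSpectralFamily.bddAbove_setOf_mem {L : Type*} [CompleteLattice L]
    {G : ℝ → L} (hG : IsBoundedOppositeSpectralFamily G) {D : Set L} (hD : IsDualIdeal D) :
    BddAbove {l : ℝ | G l ∈ D} := by
  obtain ⟨-, -, -, b, -, -, hb⟩ := hG
  refine ⟨b, fun l hl => ?_⟩
  by_contra! h
  rw [Set.mem_ofPred_eq, hb l h] at hl
  exact hD.2.1 hl

/-- Shifting a bounded opposite spectral family `G` by `t` (the opposite spectral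
family of `A + tI`) again yields a bounded opposite spectral family, and the
antonymous function gets shifted by `t`: `g_{A+tI} = t + g_A`. -/
theorem antonymous_stmt12 {L : Type*} [CompleteLattice L] (G : ℝ → L)
    (hG : IsBoundedOppositeSpectralFamily G) (t : ℝ) :
    IsBoundedOppositeSpectralFamily (fun l : ℝ => G (l - t)) ∧
    ∀ B : Set L, IsQuasipoint B →
      sSup {l : ℝ | G (l - t) ∈ B} = t + sSup {l : ℝ | G l ∈ B} := by
  refine ⟨hG.comp_sub_const t, fun B hB => ?_⟩
  have himage : {l : ℝ | G (l - t) ∈ B} = OrderIso.addLeft t '' {l : ℝ | G l ∈ B} := by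
    ext l
    simp [sub_eq_neg_add]
  rw [himage,
    ← (OrderIso.addLeft t).map_csSup' (hG.nonempty_setOf_mem hB.1) (hG.bddAbove_setOf_mem hB.1)]
  rfl
end

section
/- Let L be a complete lattice, let n ≥ 1, let b_1 ≤ b_2 ≤ ... ≤ b_{n+1} be real numbers, and let ⊤ = S_0 ≥ S_1 ≥ ... ≥ S_{n+1} = ⊥ be a decreasing chain in L. Define G : ℝ → L by G_λ = ⊤ for λ ≤ b_1, G_λ = S_k whenever b_k < λ ≤ b_{k+1} (for 1 ≤ k ≤ n), and G_λ = ⊥ for λ > b_{n+1}. Then: (a) G is a bounded opposite spectral family in L; (b) every quasipoint 𝔅 of L satisfies S_{k−1} ∈ 𝔅 and S_k ∉ 𝔅 for exactly one index k ∈ {1, ..., n+1}; (c) for this k, the antonymous function satisfies g_G(𝔅) = sSup {λ | G_λ ∈ 𝔅} = b_k. Consequently g_G = Σ_{k=1}^{n+1} b_k · χ_{Q_{S_{k−1}} ∖ Q_{S_k}} is a step function, and g_G is continuous on the Stone spectrum Q(L). -/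
/-- The Stone spectrum of `L`: quasipoints with the topology generated by the sets
`Q_P = {𝔅 | P ∈ 𝔅}`. -/
def StoneTopology (L : Type*) [CompleteLattice L] :
    TopologicalSpace {D : Set L // IsQuasipoint D} :=
  TopologicalSpace.generateFrom
    {S : Set {D : Set L // IsQuasipoint D} |
      ∃ P : L, S = {B : {D : Set L // IsQuasipoint D} | P ∈ B.1}}

theorem IsDualIdeal.top_mem {L : Type*} [CompleteLattice L] {D : Set L} (hD : IsDualIdeal D) :
    ⊤ ∈ D := by
  obtain ⟨⟨x, hx⟩, -, -, hup⟩ := hD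
  exact hup x hx ⊤ le_top

/-- An element outside a quasipoint meets some member of the quasipoint in `⊥`. -/
theorem IsQuasipoint.exists_mem_inf_eq_bot {L : Type*} [CompleteLattice L] {B : Set L}
    (hB : IsQuasipoint B) {P : L} (hP : P ∉ B) : ∃ Q ∈ B, P ⊓ Q = ⊥ := by
  obtain ⟨hD, hmax⟩ := hB
  by_contra! hne
  have hD' : IsDualIdeal {x : L | ∃ q ∈ B, P ⊓ q ≤ x} := by
    refine ⟨⟨⊤, ⊤, hD.top_mem, le_top⟩, ?_, ?_, ?_⟩
    · rintro ⟨q, hq, hle⟩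
      exact hne q hq (le_bot_iff.1 hle)
    · rintro x ⟨q, hq, hx⟩ y ⟨r, hr, hy⟩
      exact ⟨q ⊓ r, hD.2.2.1 q hq r hr, le_inf
        ((inf_le_inf_left P inf_le_left).trans hx) ((inf_le_inf_left P inf_le_right).trans hy)⟩
    · rintro x ⟨q, hq, hx⟩ y hxy
      exact ⟨q, hq, hx.trans hxy⟩
  have heq := hmax _ hD' fun x hx => ⟨x, hx, inf_le_right⟩
  exact hP (heq ▸ ⟨⊤, hD.top_mem, inf_le_left⟩)

theorem isOpen_stoneTopology_setOf_mem {L : Type*} [CompleteLattice L] (P : L) :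
    @IsOpen _ (StoneTopology L) {B : {D : Set L // IsQuasipoint D} | P ∈ B.1} :=
  TopologicalSpace.isOpen_generateFrom_of_mem ⟨P, rfl⟩

theorem isOpen_stoneTopology_setOf_notMem {L : Type*} [CompleteLattice L] (P : L) :
    @IsOpen _ (StoneTopology L) {B : {D : Set L // IsQuasipoint D} | P ∉ B.1} := by
  let _ := StoneTopology L
  refine isOpen_iff_forall_mem_open.2 fun B hP => ?_
  obtain ⟨Q, hQ, hPQ⟩ := B.2.exists_mem_inf_eq_bot hP
  refine ⟨_, fun C hC hPC => ?_, isOpen_stoneTopology_setOf_mem Q, hQ⟩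
  exact C.2.1.2.1 (hPQ ▸ C.2.1.2.2.1 P hPC Q hC)

/-- A point of `ℝ` lies left of `b 1`, right of `b (n + 1)`, or in some `(b k, b (k + 1)]`. -/
theorem le_or_exists_lt_le_or_lt (b : ℕ → ℝ) (n : ℕ) (l : ℝ) :
    l ≤ b 1 ∨ (∃ k, 1 ≤ k ∧ k ≤ n ∧ b k < l ∧ l ≤ b (k + 1)) ∨ b (n + 1) < l := by
  induction n with
  | zero => exact (le_or_gt l (b 1)).imp_right Or.inr
  | succ n ih =>
    rcases ih with h | ⟨k, h1, hk, h⟩ | h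
    · exact Or.inl h
    · exact Or.inr (Or.inl ⟨k, h1, by omega, h⟩)
    · rcases le_or_gt l (b (n + 1 + 1)) with h' | h'
      · exact Or.inr (Or.inl ⟨n + 1, by omega, le_rfl, h, h'⟩)
      · exact Or.inr (Or.inr h')

/-- Along a decreasing chain, an upward closed set is left exactly once. -/
theorem existsUnique_mem_notMem {L : Type*} [Preorder L] {B : Set L}
    (hup : ∀ x ∈ B, ∀ y, x ≤ y → y ∈ B) {S : ℕ → L} {n : ℕ}
    (hS : ∀ i j, i ≤ j → j ≤ n + 1 → S j ≤ S i) (h0 : S 0 ∈ B) (hn : S (n + 1) ∉ B) :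
    ∃! k : ℕ, 1 ≤ k ∧ k ≤ n + 1 ∧ S (k - 1) ∈ B ∧ S k ∉ B := by
  classical
  have hex : ∃ k, S k ∉ B := ⟨_, hn⟩
  have hpos : 1 ≤ Nat.find hex := by
    by_contra! h
    have := Nat.find_spec hex
    rw [Nat.lt_one_iff.1 h] at this
    exact this h0
  refine ⟨Nat.find hex, ⟨hpos, Nat.find_min' hex hn, ?_, Nat.find_spec hex⟩, ?_⟩
  · exact not_not.1 (Nat.find_min hex (by omega))
  · rintro k ⟨hk1, hkn, hmem, hnot⟩
    refine le_antisymm ?_ (Nat.find_min' hex hnot)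
    by_contra! hlt
    exact Nat.find_spec hex (hup _ hmem _ (hS _ _ (by omega) (by omega)))

open Classical in
/-- Let `b_1 ≤ ⋯ ≤ b_{n+1}` be reals and `⊤ = S_0 ≥ S_1 ≥ ⋯ ≥ S_{n+1} = ⊥` a chain
in `L`, and let `G` be the corresponding piecewise-constant family. Then (a) `G` is a
bounded opposite spectral family; (b) every quasipoint `𝔅` satisfies
`S_{k−1} ∈ 𝔅 ∧ S_k ∉ 𝔅` for exactly one `k ∈ {1,…,n+1}`; (c) for this `k`,
`g_G(𝔅) = b_k`; consequently `g_G` is the step function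
`Σ_{k=1}^{n+1} b_k · χ_{Q_{S_{k−1}} ∖ Q_{S_k}}` and is continuous on the Stone
spectrum. -/
theorem antonymous_stmt14 {L : Type*} [CompleteLattice L] (n : ℕ) (hn : 1 ≤ n)
    (b : ℕ → ℝ) (S : ℕ → L)
    (hb : ∀ k : ℕ, 1 ≤ k → k ≤ n → b k ≤ b (k + 1))
    (hS0 : S 0 = ⊤) (hStop : S (n + 1) = ⊥)
    (hS : ∀ k : ℕ, k ≤ n → S (k + 1) ≤ S k)
    (G : ℝ → L)
    (hG1 : ∀ l : ℝ, l ≤ b 1 → G l = ⊤)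
    (hG2 : ∀ k : ℕ, 1 ≤ k → k ≤ n → ∀ l : ℝ, b k < l → l ≤ b (k + 1) → G l = S k)
    (hG3 : ∀ l : ℝ, b (n + 1) < l → G l = ⊥) :
    IsBoundedOppositeSpectralFamily G ∧
    (∀ B : Set L, IsQuasipoint B →
      (∃! k : ℕ, 1 ≤ k ∧ k ≤ n + 1 ∧ S (k - 1) ∈ B ∧ S k ∉ B) ∧
      (∀ k : ℕ, 1 ≤ k → k ≤ n + 1 → S (k - 1) ∈ B → S k ∉ B →
        sSup {l : ℝ | G l ∈ B} = b k) ∧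
      sSup {l : ℝ | G l ∈ B} =
        ∑ k ∈ Finset.Icc 1 (n + 1),
          b k * (if S (k - 1) ∈ B ∧ S k ∉ B then (1 : ℝ) else 0)) ∧
    @Continuous _ _ (StoneTopology L) _
      (fun B : {D : Set L // IsQuasipoint D} => sSup {l : ℝ | G l ∈ B.1}) := by
  have hbm : ∀ i j, 1 ≤ i → i ≤ j → j ≤ n + 1 → b i ≤ b j := by
    intro i j hi hij
    induction j, hij using Nat.le_induction with
    | base => exact fun _ => le_rfl
    | succ j hij ih => exact fun hj => (ih (by omega)).trans (hb j (by omega) (by omega))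
  have hSm : ∀ i j, i ≤ j → j ≤ n + 1 → S j ≤ S i := by
    intro i j hij
    induction j, hij using Nat.le_induction with
    | base => exact fun _ => le_rfl
    | succ j hij ih => exact fun hj => (hS j (by omega)).trans (ih (by omega))
  have hGle : ∀ j l, 1 ≤ j → j ≤ n + 1 → b j < l → G l ≤ S j := by
    intro j l hj hjn hl
    rcases le_or_exists_lt_le_or_lt b n l with h | ⟨k, hk, hkn, h1, h2⟩ | h
    · exact absurd (hbm 1 j le_rfl hj hjn) (by linarith)
    · rw [hG2 k hk hkn l h1 h2]
      refine hSm _ _ ?_ (by omega)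
      by_contra! hlt
      exact absurd (hbm (k + 1) j (by omega) hlt hjn) (by linarith)
    · exact (hG3 l h).trans_le bot_le
  have hleG : ∀ j l, 1 ≤ j → j ≤ n + 1 → l ≤ b j → S (j - 1) ≤ G l := by
    intro j l hj hjn hl
    rcases le_or_exists_lt_le_or_lt b n l with h | ⟨k, hk, hkn, h1, h2⟩ | h
    · exact le_top.trans_eq (hG1 l h).symm
    · rw [hG2 k hk hkn l h1 h2]
      refine hSm _ _ ?_ (by omega)
      by_contra! hlt
      exact absurd (hbm j k hj (by omega) (by omega)) (by linarith)
    · exact absurd (hbm j (n + 1) hj hjn le_rfl) (by linarith)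
  have hanti : Antitone G := by
    intro l m hlm
    rcases le_or_exists_lt_le_or_lt b n l with h | ⟨k, hk, hkn, h1, h2⟩ | h
    · exact le_top.trans_eq (hG1 l h).symm
    · rw [hG2 k hk hkn l h1 h2]
      exact hGle k m hk (by omega) (h1.trans_le hlm)
    · exact (hG3 m (h.trans_le hlm)).trans_le bot_le
  have hleft : ∀ l, ∃ m < l, G m = G l := by
    intro l
    rcases le_or_exists_lt_le_or_lt b n l with h | ⟨k, hk, hkn, h1, h2⟩ | h
    · exact ⟨l - 1, by linarith, by rw [hG1 l h, hG1 _ (by linarith)]⟩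
    · obtain ⟨m, hm1, hm2⟩ := exists_between h1
      exact ⟨m, hm2, by rw [hG2 k hk hkn l h1 h2, hG2 k hk hkn m hm1 (by linarith)]⟩
    · obtain ⟨m, hm1, hm2⟩ := exists_between h
      exact ⟨m, hm2, by rw [hG3 l h, hG3 m hm1]⟩
  have hsup : ∀ B : Set L, IsQuasipoint B → ∀ k : ℕ, 1 ≤ k → k ≤ n + 1 → S (k - 1) ∈ B →
      S k ∉ B → sSup {l : ℝ | G l ∈ B} = b k := by
    intro B hB k hk hkn hmem hnot
    have hset : {l : ℝ | G l ∈ B} = Set.Iic (b k) := by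
      ext l
      refine ⟨fun hl => ?_, fun hl => hB.1.2.2.2 _ hmem _ (hleG k l hk hkn hl)⟩
      by_contra! hlt
      exact hnot (hB.1.2.2.2 _ hl _ (hGle k l hk hkn (not_le.1 hlt)))
    rw [hset, csSup_Iic]
  have huniq : ∀ B : Set L, IsQuasipoint B →
      ∃! k : ℕ, 1 ≤ k ∧ k ≤ n + 1 ∧ S (k - 1) ∈ B ∧ S k ∉ B := fun B hB =>
    existsUnique_mem_notMem hB.1.2.2.2 hSm (hS0 ▸ hB.1.top_mem) (hStop ▸ hB.1.2.1)
  refine ⟨⟨hanti, fun l => le_antisymm (le_iInf₂ fun m hm => hanti hm.le) ?_,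
    b 1, b (n + 1), hbm 1 _ le_rfl (by omega) le_rfl, fun l hl => hG1 l hl.le, hG3⟩,
    fun B hB => ⟨huniq B hB, hsup B hB, ?_⟩, ?_⟩
  · obtain ⟨m, hm, hGm⟩ := hleft l
    exact (iInf₂_le m hm).trans_eq hGm
  · obtain ⟨k, ⟨hk, hkn, hmem, hnot⟩, huk⟩ := huniq B hB
    rw [hsup B hB k hk hkn hmem hnot,
      Finset.sum_eq_single_of_mem k (Finset.mem_Icc.2 ⟨hk, hkn⟩), if_pos ⟨hmem, hnot⟩, mul_one]
    intro j hj hjk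
    rw [if_neg, mul_zero]
    rintro ⟨h1, h2⟩
    obtain ⟨hj1, hjn⟩ := Finset.mem_Icc.1 hj
    exact hjk (huk j ⟨hj1, hjn, h1, h2⟩)
  · let _ := StoneTopology L
    refine continuous_iff_continuousAt.2 fun B => ?_
    obtain ⟨k, ⟨hk, hkn, hmem, hnot⟩, -⟩ := huniq B.1 B.2
    refine (continuousAt_const (y := b k)).congr ?_
    filter_upwards [(isOpen_stoneTopology_setOf_mem (S (k - 1))).mem_nhds hmem,
      (isOpen_stoneTopology_setOf_notMem (S k)).mem_nhds hnot] with C h1 h2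
    exact (hsup C.1 C.2 k hk hkn h1 h2).symm
end

section
/- Let L be a complete lattice and let G be a bounded opposite spectral family in L. Then the antonymous function g_G : Q(L) → ℝ, defined on the Stone spectrum by g_G(𝔅) = sSup {λ ∈ ℝ | G_λ ∈ 𝔅}, is continuous with respect to the Stone topology on Q(L) and the standard topology on ℝ. -/
/-- An element outside a quasipoint is disjoint from some element of the quasipoint. -/
theorem IsQuasipoint.exists_inf_eq_bot {L : Type*} [CompleteLattice L] {D : Set L}
    (hD : IsQuasipoint D) {a : L} (ha : a ∉ D) : ∃ p ∈ D, p ⊓ a = ⊥ := by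
  by_contra! h
  obtain ⟨hideal, hmax⟩ := hD
  have htop := hideal.top_mem
  obtain ⟨-, -, hinf, -⟩ := hideal
  have hE : IsDualIdeal {x : L | ∃ p ∈ D, p ⊓ a ≤ x} := by
    refine ⟨⟨⊤, ⊤, htop, le_top⟩, ?_, ?_, ?_⟩
    · rintro ⟨p, hp, hle⟩
      exact h p hp (le_bot_iff.mp hle)
    · rintro x ⟨p, hp, hpx⟩ y ⟨q, hq, hqy⟩
      exact ⟨p ⊓ q, hinf p hp q hq, le_inf
        ((inf_le_inf_right a inf_le_left).trans hpx)
        ((inf_le_inf_right a inf_le_right).trans hqy)⟩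
    · rintro x ⟨p, hp, hpx⟩ y hxy
      exact ⟨p, hp, hpx.trans hxy⟩
  have hED := hmax _ hE fun x hx => ⟨x, hx, inf_le_left⟩
  exact ha (hED ▸ ⟨⊤, htop, inf_le_right⟩)

/-- The antonymous function `g_G(𝔅) = sSup {λ | G_λ ∈ 𝔅}` of a bounded opposite
spectral family `G` is continuous on the Stone spectrum. -/
theorem antonymous_stmt17 {L : Type*} [CompleteLattice L] (G : ℝ → L)
    (hG : IsBoundedOppositeSpectralFamily G) :
    @Continuous _ _ (StoneTopology L) _
      (fun B : {D : Set L // IsQuasipoint D} => sSup {l : ℝ | G l ∈ B.1}) := by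
  obtain ⟨hanti, -, a, b, -, htop, hbot⟩ := hG
  let := StoneTopology L
  have hopen (P : L) : IsOpen {B : {D : Set L // IsQuasipoint D} | P ∈ B.1} :=
    TopologicalSpace.isOpen_generateFrom_of_mem ⟨P, rfl⟩
  have hne (B : {D : Set L // IsQuasipoint D}) : {l : ℝ | G l ∈ B.1}.Nonempty := by
    refine ⟨a - 1, ?_⟩
    rw [Set.mem_ofPred_eq, htop (a - 1) (by linarith)]
    exact B.2.1.top_mem
  have hbdd (B : {D : Set L // IsQuasipoint D}) : BddAbove {l : ℝ | G l ∈ B.1} := by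
    refine ⟨b, fun l hl => ?_⟩
    by_contra! hlt
    rw [Set.mem_ofPred_eq, hbot l hlt] at hl
    exact B.2.1.2.1 hl
  refine continuous_iff_continuousAt.mpr fun B => tendsto_order.mpr ⟨fun c hc => ?_, fun c hc => ?_⟩
  · obtain ⟨l, hl, hcl⟩ := exists_lt_of_lt_csSup (hne B) hc
    filter_upwards [(hopen (G l)).mem_nhds hl] with C hC
    exact hcl.trans_le (le_csSup (hbdd C) hC)
  · obtain ⟨m, hm, hmc⟩ := exists_between hc
    obtain ⟨P, hP, hPm⟩ := B.2.exists_inf_eq_bot fun h => hm.not_ge (le_csSup (hbdd B) h)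
    filter_upwards [(hopen P).mem_nhds hP] with C hC
    refine (csSup_le (hne C) fun l hl => ?_).trans_lt hmc
    by_contra! hml
    obtain ⟨-, hbotC, hinf, hup⟩ := C.2.1
    exact hbotC (hPm ▸ hinf P hC _ (hup _ hl _ (hanti hml.le)))
end
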